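/- Let E be a Banach space, let λ ∈ (0, 1/2), let f : ℝ^d → E be a Lebesgue measurable function, and let Q ⊆ ℝ^d be a Lebesgue measurable set with 0 < |Q| < ∞. Then there exists a quasi-optimal center of oscillation of f on Q with a λ-portion disregarded, i.e., a vector c ∈ E such that ρ_λ(f − c; Q) ≤ 2 ω_λ(f; Q). -/

import Mathlib

open MeasureTheory Set

/-- The least bound `ρ_λ(f;Q)`: the infimum of all `r ≥ 0` such that
`|{x ∈ Q : ‖f(x)‖ > r}| ≤ λ|Q|`. -/
noncomputable def leastBound {E : Type*} [NormedAddCommGroup E] {d : ℕ} (lam : ℝ)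
    (f : (Fin d → ℝ) → E) (Q : Set (Fin d → ℝ)) : ℝ :=
  sInf {r : ℝ | 0 ≤ r ∧ volume {x ∈ Q | r < ‖f x‖} ≤ ENNReal.ofReal lam * volume Q}

/-- The local oscillation `ω_λ(f;Q) := inf_{c ∈ E} ρ_λ(f - c; Q)`. -/
noncomputable def localOsc {E : Type*} [NormedAddCommGroup E] {d : ℕ} (lam : ℝ)
    (f : (Fin d → ℝ) → E) (Q : Set (Fin d → ℝ)) : ℝ :=
  ⨅ c : E, leastBound lam (fun x => f x - c) Q

/-- A quasi-optimal center of oscillation of `f` on `Q` with a `λ`-portion disregarded: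
any `m ∈ E` with `ρ_λ(f - m; Q) ≤ 2 ω_λ(f;Q)`. -/
def IsQuasiCenter {E : Type*} [NormedAddCommGroup E] {d : ℕ} (lam : ℝ)
    (f : (Fin d → ℝ) → E) (Q : Set (Fin d → ℝ)) (m : E) : Prop :=
  leastBound lam (fun x => f x - m) Q ≤ 2 * localOsc lam f Q

/-- On a set of finite measure, the set of admissible bounds defining `leastBound` is nonempty. -/
theorem exists_admissible_bound {E : Type*} [NormedAddCommGroup E] {d : ℕ} {lam : ℝ}
    (hlam0 : 0 < lam) {f : (Fin d → ℝ) → E} (hf : AEStronglyMeasurable f volume)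
    {Q : Set (Fin d → ℝ)} (hQmeas : MeasurableSet Q) (hQpos : 0 < volume Q)
    (hQfin : volume Q < ⊤) :
    {r : ℝ | 0 ≤ r ∧ volume {x ∈ Q | r < ‖f x‖} ≤ ENNReal.ofReal lam * volume Q}.Nonempty := by
  have hmeas : ∀ n : ℕ, NullMeasurableSet {x ∈ Q | (n : ℝ) < ‖f x‖} volume := fun n =>
    hQmeas.nullMeasurableSet.inter (nullMeasurableSet_lt aemeasurable_const hf.norm.aemeasurable)
  have hanti : Antitone fun n : ℕ => {x ∈ Q | (n : ℝ) < ‖f x‖} := fun m n hmn x hx =>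
    ⟨hx.1, lt_of_le_of_lt (by exact_mod_cast hmn) hx.2⟩
  have hlim := tendsto_measure_iInter_atTop (μ := volume) hmeas hanti
    ⟨0, ((measure_mono fun x hx => hx.1).trans_lt hQfin).ne⟩
  have hempty : ⋂ n : ℕ, {x ∈ Q | (n : ℝ) < ‖f x‖} = ∅ := by
    refine eq_empty_of_forall_notMem fun x hx => ?_
    obtain ⟨n, hn⟩ := exists_nat_ge ‖f x‖
    exact hn.not_gt (mem_iInter.1 hx n).2
  rw [hempty, measure_empty] at hlim
  have hpos : 0 < ENNReal.ofReal lam * volume Q :=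
    ENNReal.mul_pos (ENNReal.ofReal_pos.2 hlam0).ne' hQpos.ne'
  obtain ⟨n, hn⟩ := (hlim.eventually (gt_mem_nhds hpos)).exists
  exact ⟨n, n.cast_nonneg, hn.le⟩

theorem leastBound_nonneg {E : Type*} [NormedAddCommGroup E] {d : ℕ} (lam : ℝ)
    (f : (Fin d → ℝ) → E) (Q : Set (Fin d → ℝ)) : 0 ≤ leastBound lam f Q :=
  Real.sInf_nonneg fun _ hr => hr.1

theorem leastBound_le {E : Type*} [NormedAddCommGroup E] {d : ℕ} {lam : ℝ}
    {f : (Fin d → ℝ) → E} {Q : Set (Fin d → ℝ)} {r : ℝ} (hr : 0 ≤ r)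
    (h : volume {x ∈ Q | r < ‖f x‖} ≤ ENNReal.ofReal lam * volume Q) :
    leastBound lam f Q ≤ r :=
  csInf_le ⟨0, fun _ hs => hs.1⟩ ⟨hr, h⟩

/-- Two centers whose balls each capture more than half of `Q` are close. -/
theorem norm_sub_le_of_volume_le {E : Type*} [NormedAddCommGroup E] {d : ℕ} {lam : ℝ}
    (hlam0 : 0 < lam) (hlam : lam < 1 / 2) {f : (Fin d → ℝ) → E} {Q : Set (Fin d → ℝ)}
    (hQpos : 0 < volume Q) (hQfin : volume Q < ⊤) {a b : E} {r s : ℝ}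
    (ha : volume {x ∈ Q | r < ‖f x - a‖} ≤ ENNReal.ofReal lam * volume Q)
    (hb : volume {x ∈ Q | s < ‖f x - b‖} ≤ ENNReal.ofReal lam * volume Q) :
    ‖a - b‖ ≤ r + s := by
  by_contra! hab
  have hcover : Q ⊆ {x ∈ Q | r < ‖f x - a‖} ∪ {x ∈ Q | s < ‖f x - b‖} := by
    intro x hx
    by_contra hnot
    simp only [mem_union, mem_ofPred_eq, hx, true_and, not_or, not_lt] at hnot
    have htri := norm_sub_le_norm_sub_add_norm_sub a (f x) b
    rw [norm_sub_rev a (f x)] at htri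
    linarith [hnot.1, hnot.2]
  have hle : volume Q ≤ ENNReal.ofReal (lam + lam) * volume Q := by
    rw [ENNReal.ofReal_add hlam0.le hlam0.le, add_mul]
    exact (measure_mono hcover).trans ((measure_union_le _ _).trans (add_le_add ha hb))
  have hlt : ENNReal.ofReal (lam + lam) < 1 := ENNReal.ofReal_lt_one.2 (by linarith)
  have hmul := ENNReal.mul_lt_mul_left hQpos.ne' hQfin.ne hlt
  rw [one_mul] at hmul
  exact hmul.not_ge hle

/-- existence of a quasi-optimal center of oscillation. -/
theorem exists_quasiCenter {E : Type*} [NormedAddCommGroup E] [NormedSpace ℝ E]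
    [CompleteSpace E] {d : ℕ} (lam : ℝ) (hlam0 : 0 < lam) (hlam : lam < 1 / 2)
    (f : (Fin d → ℝ) → E) (hf : AEStronglyMeasurable f volume)
    (Q : Set (Fin d → ℝ)) (hQmeas : MeasurableSet Q)
    (hQpos : 0 < volume Q) (hQfin : volume Q < ⊤) :
    ∃ c : E, leastBound lam (fun x => f x - c) Q ≤ 2 * localOsc lam f Q := by
  have hnonneg : 0 ≤ localOsc lam f Q := Real.iInf_nonneg fun c => leastBound_nonneg _ _ _
  rcases hnonneg.eq_or_lt with hzero | hpos
  · have hcenter : ∀ ε : ℝ, 0 < ε → ∃ c : E, ∃ r : ℝ, r < ε ∧ 0 ≤ r ∧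
        volume {x ∈ Q | r < ‖f x - c‖} ≤ ENNReal.ofReal lam * volume Q := by
      intro ε hε
      rw [hzero] at hε
      obtain ⟨c, hc⟩ := exists_lt_of_ciInf_lt hε
      obtain ⟨r, hr, hrε⟩ := exists_lt_of_csInf_lt
        (exists_admissible_bound hlam0 (hf.sub aestronglyMeasurable_const) hQmeas hQpos hQfin) hc
      exact ⟨c, r, hrε, hr⟩
    choose c r hrlt hr0 hvol using fun n : ℕ => hcenter (1 / ((n : ℝ) + 1)) (by positivity)
    have hrlim : Filter.Tendsto r Filter.atTop (nhds 0) :=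
      squeeze_zero hr0 (fun n => (hrlt n).le) tendsto_one_div_add_atTop_nhds_zero_nat
    have hdist : ∀ m n, ‖c m - c n‖ ≤ r m + r n := fun m n =>
      norm_sub_le_of_volume_le hlam0 hlam hQpos hQfin (hvol m) (hvol n)
    have hcauchy : CauchySeq c := by
      refine Metric.cauchySeq_iff.2 fun ε hε => ?_
      obtain ⟨N, hN⟩ := Filter.eventually_atTop.1 (hrlim.eventually (gt_mem_nhds (half_pos hε)))
      refine ⟨N, fun m hm n hn => ?_⟩
      rw [dist_eq_norm]
      linarith [hdist m n, hN m hm, hN n hn]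
    obtain ⟨c₀, hc₀⟩ := cauchySeq_tendsto_of_complete hcauchy
    have hlimdist : ∀ n, ‖c n - c₀‖ ≤ r n := fun n => by
      have hright := hrlim.const_add (r n)
      rw [add_zero] at hright
      exact le_of_tendsto_of_tendsto' (hc₀.const_sub (c n)).norm hright (hdist n)
    have hbound : ∀ n, leastBound lam (fun x => f x - c₀) Q ≤ r n + r n := fun n => by
      refine leastBound_le (add_nonneg (hr0 n) (hr0 n)) ((measure_mono ?_).trans (hvol n))
      rintro x ⟨hx, hxr⟩
      refine ⟨hx, ?_⟩
      linarith [norm_sub_le_norm_sub_add_norm_sub (f x) (c n) c₀, hlimdist n]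
    refine ⟨c₀, ?_⟩
    rw [← hzero, mul_zero, ← add_zero (0 : ℝ)]
    exact ge_of_tendsto' (hrlim.add hrlim) hbound
  · obtain ⟨c, hc⟩ := exists_lt_of_ciInf_lt
      (show localOsc lam f Q < 2 * localOsc lam f Q by linarith)
    exact ⟨c, hc.le⟩
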